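/- For all positive integers μ₁ and μ₂, the pruned simple Hurwitz number satisfies K_{0,2}(μ₁, μ₂) = μ₁·μ₂·A(μ₁+μ₂−1, μ₁−1), where A(m,k) is the Eulerian number. -/

import Mathlib

/-- `σ` is a tuple of `m` transpositions in the symmetric group on `d` letters whose
ordered product is `T`, which generates a subgroup acting transitively, and such that
every point is moved by at least two of the transpositions.  These are the objects
counted by the pruned simple Hurwitz numbers. -/
def IsPrunedFactorisation {d m : ℕ} (T : Equiv.Perm (Fin d))
    (σ : Fin m → Equiv.Perm (Fin d)) : Prop :=
  (∀ i, (σ i).IsSwap) ∧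
  (List.ofFn σ).prod = T ∧
  (∀ x y : Fin d, ∃ g ∈ Subgroup.closure (Set.range σ), g x = y) ∧
  (∀ x : Fin d, 2 ≤ Nat.card {i : Fin m // σ i x ≠ x})

/-- The number of ascents of a permutation `π` of `{0, …, m-1}`: the number of
indices `i` with `i + 1 < m` and `π i < π (i+1)`. -/
noncomputable def ascents {m : ℕ} (π : Equiv.Perm (Fin m)) : ℕ :=
  Nat.card {i : Fin m // ∃ h : (i : ℕ) + 1 < m, π i < π ⟨(i : ℕ) + 1, h⟩}

/-- The Eulerian number `A(m, k)`: the number of permutations of an `m`-element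
linearly ordered set with exactly `k` ascents. -/
noncomputable def eulerianNumber (m k : ℕ) : ℕ :=
  Nat.card {π : Equiv.Perm (Fin m) // ascents π = k}

open Equiv
theorem prod_inv {α : Type*} : ∀ {m : ℕ} (σ : Fin m → Perm α) (I : ℕ → α → Prop) (x : α),
    I m x → (∀ t : Fin m, ∀ y, I (t+1) y → I t (σ t y)) → I 0 ((List.ofFn σ).prod x) := by
  intro m
  induction m with
  | zero => intro σ I x h _; simpa using h
  | succ m ih =>
    intro σ I x h hs
    rw [List.ofFn_succ, List.prod_cons, Perm.mul_apply]
    apply hs 0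
    have := ih (fun i => σ i.succ) (fun t => I (t+1)) x h (fun t y hy => by simpa using hs t.succ y (by simpa using hy))
    simpa using this

def cyc {n : ℕ} (l : Perm (Fin (n+2))) : Perm (Fin (n+2)) :=
  (List.ofFn fun t => swap (l.symm t) (l.symm t + 1)).prod

theorem succ_ne {n : ℕ} (i : Fin (n+2)) : i + 1 ≠ i := by
  intro h
  simp at h

theorem fin_lt_add {n : ℕ} (i : Fin (n+2)) : i + 1 = 0 ∨ i < i + 1 := by
  rcases eq_or_ne i (Fin.last _) with h | h
  · left; subst h; simp
  · right; exact Fin.lt_add_one_iff.2 (lt_of_le_of_ne (Fin.le_last _) h)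

theorem le_max {n : ℕ} {l : Perm (Fin (n+2))} (h0 : l 0 = Fin.last _) (t : Fin (n+2)) : t ≤ l 0 := by
  rw [h0]; exact Fin.le_last _

theorem cycA {n : ℕ} {l : Perm (Fin (n+2))} (h0 : l 0 = Fin.last _) (i : Fin (n+2))
    (hi : l (i-1) < l i) : l (cyc l i - 1) < l (cyc l i) ∧ (cyc l i = 0 ∨ i < cyc l i) := by
  have key := prod_inv (fun t => swap (l.symm t) (l.symm t + 1))
    (fun t x => (x = i ∧ (l i : ℕ) < t) ∨ ∃ k, x = k + 1 ∧ t ≤ (l k : ℕ) ∧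
      (l (k+1) < l k → (l (k+1) : ℕ) < t) ∧ (k + 1 = 0 ∨ i < k + 1)) i
    (Or.inl ⟨rfl, (l i).2⟩) (by
      rintro t y (⟨rfl, hy⟩ | ⟨k, rfl, hk, hk1, hk2⟩)
      · obtain ⟨e, rfl⟩ := l.surjective t
        simp only [symm_apply_apply]
        by_cases he : e = y
        · subst he
          right
          refine ⟨e, by simp, le_rfl, fun h => h, fin_lt_add e⟩
        · left
          have h1 : (l y : ℕ) ≠ l e := fun h => he (l.injective (Fin.ext h)).symm
          have h2 : y ≠ e + 1 := by
            rintro rfl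
            simp at hi
            omega
          refine ⟨swap_apply_of_ne_of_ne (Ne.symm he) h2, by omega⟩
      · obtain ⟨e, rfl⟩ := l.surjective t
        simp only [symm_apply_apply]
        have hek : e ≠ k := by rintro rfl; omega
        by_cases he : e = k + 1
        · subst he
          right
          refine ⟨k+1, by simp, le_rfl, fun h => h, ?_⟩
          rcases hk2 with h | h
          · have := (l k).2
            rw [h, h0, Fin.val_last] at hk
            omega
          · rcases fin_lt_add (k+1) with h' | h'
            · exact Or.inl h'
            · exact Or.inr (h.trans h')
        · right
          refine ⟨k, ?_, by omega, ?_, hk2⟩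
          · apply swap_apply_of_ne_of_ne (Ne.symm he)
            intro h; exact hek (add_right_cancel h).symm
          · intro h
            have h1 : (l (k+1) : ℕ) ≠ l e := fun h => he (l.injective (Fin.ext h)).symm
            have := hk1 h
            omega)
  change (cyc l i = i ∧ _) ∨ ∃ k, cyc l i = k + 1 ∧ _ at key
  rcases key with ⟨_, h⟩ | ⟨k, hx, _, h1, h2⟩
  · omega
  · rw [hx]
    refine ⟨?_, h2⟩
    simp only [add_sub_cancel_right]
    by_contra hc
    rcases lt_or_eq_of_le (not_lt.1 hc) with h | h
    · have := h1 h; omega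
    · exact succ_ne k (l.injective h)

theorem cycD {n : ℕ} {l : Perm (Fin (n+2))} (h0 : l 0 = Fin.last _) (i : Fin (n+2))
    (hi : ¬ l (i-1) < l i) : ¬ l (cyc l i - 1) < l (cyc l i) ∧ (i = 1 ∨ cyc l i < i) := by
  have hi' : l i < l (i-1) := by
    refine lt_of_le_of_ne (not_lt.1 hi) fun h => ?_
    have := l.injective h
    exact succ_ne (i-1) (by simpa using this)
  have pred_lt : ∀ k : Fin (n+2), k ≠ 0 → k - 1 < k := by
    intro k hk
    rcases fin_lt_add (k-1) with h | h
    · simp at h; exact absurd h hk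
    · simpa using h
  have i0 : i ≠ 0 := by
    rintro rfl
    exact absurd hi' (not_lt.2 (le_max h0 _))
  have key := prod_inv (fun t => swap (l.symm t) (l.symm t + 1))
    (fun t x => (x = i ∧ (l (i-1) : ℕ) < t) ∨ ∃ k, x = k ∧ t ≤ (l k : ℕ) ∧
      (l (k-1) < l k → (l (k-1) : ℕ) < t) ∧ (i = 1 ∨ (k ≠ 0 ∧ k < i))) i
    (Or.inl ⟨rfl, (l (i-1)).2⟩) (by
      rintro t y (⟨rfl, hy⟩ | ⟨k, rfl, hk, hk1, hk2⟩)
      · obtain ⟨e, rfl⟩ := l.surjective t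
        simp only [symm_apply_apply]
        by_cases he : e = y - 1
        · subst he
          right
          refine ⟨y - 1, by simp, le_rfl, fun h => h, ?_⟩
          by_cases hy1 : y = 1
          · exact Or.inl hy1
          · exact Or.inr ⟨fun h => hy1 (by simpa [sub_eq_zero] using h), pred_lt _ i0⟩
        · left
          have h1 : (l (y-1) : ℕ) ≠ l e := fun h => he (l.injective (Fin.ext h)).symm
          have h2 : y ≠ e := by
            rintro rfl
            omega
          refine ⟨swap_apply_of_ne_of_ne h2 (fun h => he (by rw [h]; simp)), by omega⟩
      · obtain ⟨e, rfl⟩ := l.surjective t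
        simp only [symm_apply_apply]
        have hek : e ≠ y := by rintro rfl; omega
        by_cases he : e = y - 1
        · subst he
          right
          refine ⟨y-1, by simp, le_rfl, fun h => h, ?_⟩
          rcases hk2 with h | ⟨h, h'⟩
          · exact Or.inl h
          · right
            refine ⟨fun h2 => ?_, (pred_lt _ h).trans h'⟩
            have := (l y).2
            rw [h2, h0, Fin.val_last] at hk
            omega
        · right
          refine ⟨y, ?_, by omega, ?_, hk2⟩
          · apply swap_apply_of_ne_of_ne (Ne.symm hek)
            intro h; exact he (by rw [h]; simp)
          · intro h
            have h1 : (l (y-1) : ℕ) ≠ l e := fun h => he (l.injective (Fin.ext h)).symm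
            have := hk1 h
            omega)
  change (cyc l i = i ∧ _) ∨ ∃ k, cyc l i = k ∧ _ at key
  rcases key with ⟨_, h⟩ | ⟨k, hx, _, h1, h2⟩
  · omega
  · rw [hx]
    refine ⟨fun h => ?_, h2.imp id And.right⟩
    have := h1 h
    omega

def Asc {n : ℕ} (l : Perm (Fin (n+2))) (i : Fin (n+2)) : Prop := l (i-1) < l i

theorem asc_zero {n : ℕ} {l : Perm (Fin (n+2))} (h0 : l 0 = Fin.last _) : Asc l 0 := by
  refine lt_of_le_of_ne (le_max h0 _) fun h => ?_
  have := l.injective h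
  exact succ_ne (0-1 : Fin (n+2)) (by simpa using this.symm)

theorem asc_one {n : ℕ} {l : Perm (Fin (n+2))} (h0 : l 0 = Fin.last _) : ¬ Asc l 1 := by
  unfold Asc
  simpa using le_max h0 _

theorem asc_cyc {n : ℕ} {l : Perm (Fin (n+2))} (h0 : l 0 = Fin.last _) (i : Fin (n+2)) :
    Asc l (cyc l i) ↔ Asc l i := by
  by_cases h : Asc l i
  · exact iff_of_true (cycA h0 i h).1 h
  · exact iff_of_false (cycD h0 i h).1 h

theorem same_zero {n : ℕ} {l : Perm (Fin (n+2))} (h0 : l 0 = Fin.last _) (i : Fin (n+2))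
    (h : Asc l i) : (cyc l).SameCycle 0 i := by
  induction i using WellFoundedGT.induction with
  | ind i ih =>
    obtain ⟨h1, h2⟩ := cycA h0 i h
    rw [← Perm.sameCycle_apply_right]
    rcases h2 with h2 | h2
    · rw [h2]
    · exact ih _ h2 h1

theorem same_one {n : ℕ} {l : Perm (Fin (n+2))} (h0 : l 0 = Fin.last _) (i : Fin (n+2))
    (h : ¬ Asc l i) : (cyc l).SameCycle 1 i := by
  induction i using WellFoundedLT.induction with
  | ind i ih =>
    obtain ⟨h1, h2⟩ := cycD h0 i h
    rcases h2 with h2 | h2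
    · rw [h2]
    · rw [← Perm.sameCycle_apply_right]; exact ih _ h2 h1

theorem same_zero_iff {n : ℕ} {l : Perm (Fin (n+2))} (h0 : l 0 = Fin.last _) (i : Fin (n+2)) :
    (cyc l).SameCycle 0 i ↔ Asc l i := by
  refine ⟨fun h => ?_, same_zero h0 i⟩
  obtain ⟨k, -, rfl⟩ := h.exists_pow_eq'
  clear h
  induction k with
  | zero => simpa using asc_zero h0
  | succ k ih =>
    rw [pow_succ', Perm.mul_apply, asc_cyc h0]
    exact ih



theorem minPer {γ : Type*} [Finite γ] (Q : Perm γ) (x : γ) :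
      Function.minimalPeriod (Q • ·) x = Nat.card {y // Q.SameCycle x y} := by
  have := Fintype.ofFinite γ
  have := Fintype.ofFinite (MulAction.orbit (Subgroup.zpowers Q) x)
  rw [MulAction.minimalPeriod_eq_card, ← Nat.card_eq_fintype_card]
  apply Nat.card_congr
  apply Equiv.subtypeEquivRight
  intro y
  simp only [MulAction.mem_orbit_iff, Perm.SameCycle]
  constructor
  · rintro ⟨⟨_, k, rfl⟩, h⟩; exact ⟨k, h⟩
  · rintro ⟨k, h⟩; exact ⟨⟨_, k, rfl⟩, h⟩

theorem zpow_eq_iff {γ : Type*} [Finite γ] (Q : Perm γ) (x : γ) (k j : ℤ) :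
    (Q ^ k) x = (Q ^ j) x ↔ (Nat.card {y // Q.SameCycle x y} : ℤ) ∣ k - j := by
  rw [← minPer, ← MulAction.zpow_smul_eq_iff_minimalPeriod_dvd, sub_eq_neg_add, zpow_add,
    zpow_neg, mul_smul, inv_smul_eq_iff]
  rfl

theorem exists_intertwine {α β : Type*} [Finite α] [Finite β] (P : Perm α) (T : Perm β)
    {x₀ x₁ : α} {y₀ y₁ : β} (hc : ∀ x, P.SameCycle x₀ x ∨ P.SameCycle x₁ x)
    (hn : ¬ P.SameCycle x₀ x₁)
    (hc' : ∀ x, T.SameCycle y₀ x ∨ T.SameCycle y₁ x) (hn' : ¬ T.SameCycle y₀ y₁)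
    (h₀ : Nat.card {x // P.SameCycle x₀ x} = Nat.card {y // T.SameCycle y₀ y})
    (h₁ : Nat.card {x // P.SameCycle x₁ x} = Nat.card {y // T.SameCycle y₁ y}) :
    ∃ v : α ≃ β, v x₀ = y₀ ∧ v x₁ = y₁ ∧ ∀ x, v (P x) = T (v x) := by
  classical
  have e₀ : ∀ k j : ℤ, (P ^ k) x₀ = (P ^ j) x₀ ↔ (T ^ k) y₀ = (T ^ j) y₀ := by
    intro k j; rw [zpow_eq_iff, zpow_eq_iff, h₀]
  have e₁ : ∀ k j : ℤ, (P ^ k) x₁ = (P ^ j) x₁ ↔ (T ^ k) y₁ = (T ^ j) y₁ := by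
    intro k j; rw [zpow_eq_iff, zpow_eq_iff, h₁]
  have ex : ∀ x, ∃ y, (∀ k : ℤ, (P ^ k) x₀ = x → (T ^ k) y₀ = y) ∧
      (∀ k : ℤ, (P ^ k) x₁ = x → (T ^ k) y₁ = y) := by
    intro x
    rcases hc x with ⟨k, rfl⟩ | ⟨k, rfl⟩
    · refine ⟨(T ^ k) y₀, fun j hj => (e₀ _ _).1 hj, fun j hj => ?_⟩
      exact absurd ((Perm.sameCycle_zpow_right.2 (Perm.SameCycle.refl P x₀)).trans
        (show P.SameCycle ((P ^ k) x₀) x₁ from (Perm.SameCycle.symm ⟨j, hj⟩))) hn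
    · refine ⟨(T ^ k) y₁, fun j hj => ?_, fun j hj => (e₁ _ _).1 hj⟩
      refine absurd (Perm.SameCycle.trans (y := (P ^ k) x₁) ⟨j, hj⟩ (Perm.SameCycle.symm ⟨k, rfl⟩)) hn
  choose v hv₀ hv₁ using ex
  have f₀ : ∀ k : ℤ, v ((P ^ k) x₀) = (T ^ k) y₀ := fun k => (hv₀ _ k rfl).symm
  have f₁ : ∀ k : ℤ, v ((P ^ k) x₁) = (T ^ k) y₁ := fun k => (hv₁ _ k rfl).symm
  have inj : Function.Injective v := by
    intro x x' h
    rcases hc x with ⟨k, rfl⟩ | ⟨k, rfl⟩ <;> rcases hc x' with ⟨j, rfl⟩ | ⟨j, rfl⟩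
    · rw [f₀, f₀] at h; exact (e₀ _ _).2 h
    · rw [f₀, f₁] at h
      exact absurd (Perm.SameCycle.trans (y := (T ^ j) y₁) ⟨k, h⟩ (Perm.SameCycle.symm ⟨j, rfl⟩)) hn'
    · rw [f₀, f₁] at h
      exact absurd (Perm.SameCycle.trans (y := (T ^ k) y₁) ⟨j, h.symm⟩ (Perm.SameCycle.symm ⟨k, rfl⟩)) hn'
    · rw [f₁, f₁] at h; exact (e₁ _ _).2 h
  have surj : Function.Surjective v := by
    intro y
    rcases hc' y with ⟨k, rfl⟩ | ⟨k, rfl⟩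
    · exact ⟨_, f₀ k⟩
    · exact ⟨_, f₁ k⟩
  refine ⟨Equiv.ofBijective v ⟨inj, surj⟩, f₀ 0, f₁ 0, fun x => ?_⟩
  change v (P x) = T (v x)
  rcases hc x with ⟨k, rfl⟩ | ⟨k, rfl⟩
  · rw [f₀, ← Perm.mul_apply, ← zpow_one_add, f₀, ← Perm.mul_apply, ← zpow_one_add]
  · rw [f₁, ← Perm.mul_apply, ← zpow_one_add, f₁, ← Perm.mul_apply, ← zpow_one_add]

theorem cycleType_rot (m : ℕ) (hm : 1 ≤ m) :
    (finRotate m).cycleType = Multiset.filter (fun x => 2 ≤ x) {m} := by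
  match m, hm with
  | 1, _ =>
    rw [Subsingleton.elim (finRotate 1) 1]; simp [Multiset.filter_singleton]
  | m+2, _ => simp [Multiset.filter_singleton, cycleType_finRotate]

theorem same_rot (m : ℕ) (i j : Fin m) : (finRotate m).SameCycle i j := by
  match m with
  | 0 => exact i.elim0
  | m+1 =>
    have : ∀ i, (finRotate (m+1)).SameCycle 0 i := by
      intro i
      induction i using Fin.induction with
      | zero => rfl
      | succ i ih => 
        have : i.succ = finRotate (m+1) i.castSucc := by simp
        rw [this, Perm.sameCycle_apply_right]; exact ih
    exact (this i).symm.trans (this j)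

theorem orbits_exist (μ₁ μ₂ d : ℕ) (h₁ : 1 ≤ μ₁) (h₂ : 1 ≤ μ₂) (hd : μ₁ + μ₂ = d)
    (T : Equiv.Perm (Fin d))
    (hT : T.cycleType = Multiset.filter (fun x => 2 ≤ x) ({μ₁, μ₂} : Multiset ℕ)) :
    ∃ a b, ¬ T.SameCycle a b ∧ (∀ x, T.SameCycle a x ∨ T.SameCycle b x) ∧
      Nat.card {x // T.SameCycle a x} = μ₁ ∧ Nat.card {x // T.SameCycle b x} = μ₂ := by
  subst hd
  let p : Fin (μ₁ + μ₂) → Prop := fun x => (x : ℕ) < μ₁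
  have c1 : Fintype.card {x // p x} = μ₁ := by
    rw [Fintype.card_subtype]
    simp [p]
    have := Fin.card_filter_val_lt (n := μ₁ + μ₂) (m := μ₁)
    simpa using this
  have c2 : Fintype.card {x // ¬ p x} = μ₂ := by
    rw [Fintype.card_subtype_compl, c1]; simp
  let f₁ : Fin μ₁ ≃ {x // p x} := Fintype.equivOfCardEq (by simp [c1])
  let f₂ : Fin μ₂ ≃ {x // ¬ p x} := Fintype.equivOfCardEq (by simp [c2])
  let T₀ := (finRotate μ₁).extendDomain f₁ * (finRotate μ₂).extendDomain f₂
  have q1 : ∀ i, T₀ (f₁ i) = f₁ (finRotate μ₁ i) := by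
    intro i
    simp only [T₀, Perm.mul_apply]
    rw [Perm.extendDomain_apply_not_subtype _ f₂ (not_not.2 (f₁ i).2), Perm.extendDomain_apply_image]
  have q2 : ∀ i, T₀ (f₂ i) = f₂ (finRotate μ₂ i) := by
    intro i
    simp only [T₀, Perm.mul_apply]
    rw [Perm.extendDomain_apply_image, Perm.extendDomain_apply_not_subtype _ f₁ (f₂ _).2]
  have dis : Perm.Disjoint ((finRotate μ₁).extendDomain f₁) ((finRotate μ₂).extendDomain f₂) := by
    intro x
    by_cases h : p x
    · right; exact Perm.extendDomain_apply_not_subtype _ f₂ (not_not.2 h)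
    · left; exact Perm.extendDomain_apply_not_subtype _ f₁ h
  have ct : T₀.cycleType = T.cycleType := by
    rw [hT, dis.cycleType_mul, Perm.cycleType_extendDomain, Perm.cycleType_extendDomain,
      cycleType_rot _ h₁, cycleType_rot _ h₂, ← Multiset.filter_add]
    rfl
  obtain ⟨c, hc⟩ := isConj_iff.1 (Perm.isConj_iff_cycleType_eq.2 ct)
  have pw1 : ∀ (k : ℕ) i, (T₀ ^ k) (f₁ i) = f₁ ((finRotate μ₁ ^ k) i) := by
    intro k; induction k with
    | zero => simp
    | succ k ih => intro i; rw [pow_succ', pow_succ', Perm.mul_apply, Perm.mul_apply, ih]; exact q1 _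
  have pw2 : ∀ (k : ℕ) i, (T₀ ^ k) (f₂ i) = f₂ ((finRotate μ₂ ^ k) i) := by
    intro k; induction k with
    | zero => simp
    | succ k ih => intro i; rw [pow_succ', pow_succ', Perm.mul_apply, Perm.mul_apply, ih]; exact q2 _
  have s1 : ∀ i x, T₀.SameCycle (f₁ i) x ↔ p x := by
    intro i x
    constructor
    · intro h
      obtain ⟨k, -, rfl⟩ := h.exists_pow_eq'
      rw [pw1]; exact (f₁ _).2
    · intro h
      obtain ⟨j, hj⟩ := f₁.surjective ⟨x, h⟩
      obtain ⟨k, -, hk⟩ := (same_rot _ i j).exists_pow_eq'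
      refine ⟨k, ?_⟩
      rw [zpow_natCast, pw1, hk, hj]
  have s2 : ∀ i x, T₀.SameCycle (f₂ i) x ↔ ¬ p x := by
    intro i x
    constructor
    · intro h
      obtain ⟨k, -, rfl⟩ := h.exists_pow_eq'
      rw [pw2]; exact (f₂ _).2
    · intro h
      obtain ⟨j, hj⟩ := f₂.surjective ⟨x, h⟩
      obtain ⟨k, -, hk⟩ := (same_rot _ i j).exists_pow_eq'
      refine ⟨k, ?_⟩
      rw [zpow_natCast, pw2, hk, hj]
  have t1 : ∀ i x, T.SameCycle (c (f₁ i)) x ↔ p (c⁻¹ x) := by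
    intro i x
    rw [← hc, Perm.sameCycle_conj, ← s1 i]; simp
  have t2 : ∀ i x, T.SameCycle (c (f₂ i)) x ↔ ¬ p (c⁻¹ x) := by
    intro i x
    rw [← hc, Perm.sameCycle_conj, ← s2 i]; simp
  refine ⟨c (f₁ ⟨0, h₁⟩), c (f₂ ⟨0, h₂⟩), ?_, ?_, ?_, ?_⟩
  · rw [t1]; simpa using (f₂ ⟨0, h₂⟩).2
  · intro x; rw [t1, t2]; exact em _
  · simp only [t1]
    refine Eq.trans ?_ (Nat.card_eq_fintype_card.trans c1)
    exact Nat.card_congr (c⁻¹.subtypeEquiv (fun x => Iff.rfl))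
  · simp only [t2]
    refine Eq.trans ?_ (Nat.card_eq_fintype_card.trans c2)
    exact Nat.card_congr (c⁻¹.subtypeEquiv (fun x => Iff.rfl))


theorem swap_eq_of_apply {α : Type*} [DecidableEq α] {τ : Perm α} (h : τ.IsSwap) {x y : α}
    (hy : τ x = y) (hne : y ≠ x) : τ = swap x y := by
  obtain ⟨a, b, hab, rfl⟩ := h
  rw [swap_apply_def] at hy
  split_ifs at hy with h1 h2
  · rw [h1, hy]
  · rw [h2, hy, swap_comm]
  · exact absurd hy.symm hne

/-- dihedral fact -/
theorem no_reflect {D : Type*} (o s N : Perm D) (ho : ∀ z, o (o z) = z) (hs : ∀ z, s (s z) = z)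
    (hN : ∀ z, N z = o (s z)) (fo : ∀ z, o z ≠ z) (fs : ∀ z, s z ≠ z) (y : D) (k : ℤ) :
    (N ^ k) y ≠ o y := by
  have hN' : N = o * s := Equiv.ext hN
  have ho' : o⁻¹ = o := inv_eq_of_mul_eq_one_left (Equiv.ext ho)
  have hs' : s⁻¹ = s := inv_eq_of_mul_eq_one_left (Equiv.ext hs)
  have c1 : o * N * o⁻¹ = N⁻¹ := by rw [hN', mul_inv_rev, ho', hs', ← mul_assoc]; 
                                    nth_rewrite 1 [← ho']; simp
  have c2 : ∀ j : ℤ, o * N ^ j = N ^ (-j) * o := by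
    intro j
    rw [zpow_neg, ← inv_zpow, ← c1, conj_zpow]; simp
  have c3 : ∀ (j : ℤ) z, o ((N ^ j) z) = (N ^ (-j)) (o z) := fun j z => congrArg (· z) (c2 j)
  intro h
  rcases Int.even_or_odd' k with ⟨j, rfl | rfl⟩
  · apply fo ((N ^ j) y)
    rw [c3, ← h, ← Perm.mul_apply, ← zpow_add]
    congr 2; ring
  · apply fs ((N ^ j) y)
    apply o.injective
    rw [c3 j y, ← h, ← hN, ← Perm.mul_apply, ← Perm.mul_apply, ← zpow_add, ← zpow_one_add]
    congr 2; ring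

theorem deg_two {n : ℕ} (σ : Fin n → Perm (Fin n)) (hs : ∀ i, (σ i).IsSwap)
    (hd : ∀ x : Fin n, 2 ≤ Nat.card {i : Fin n // σ i x ≠ x}) (x : Fin n) :
    (Finset.univ.filter fun i => σ i x ≠ x).card = 2 := by
  have hd' : ∀ x, 2 ≤ (Finset.univ.filter fun i => σ i x ≠ x).card := by
    intro x
    have := hd x
    rwa [Nat.card_eq_fintype_card, Fintype.card_subtype] at this
  have tot : ∑ x, (Finset.univ.filter fun i => σ i x ≠ x).card = ∑ x : Fin n, 2 := by
    simp_rw [Finset.card_filter]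
    rw [Finset.sum_comm]
    apply Finset.sum_congr rfl
    intro i _
    rw [← Finset.card_filter]
    exact Perm.card_support_eq_two.2 (hs i)
  exact ((Finset.sum_eq_sum_iff_of_le (fun x _ => hd' x)).1 tot.symm x (Finset.mem_univ _)).symm

theorem other_exists {n : ℕ} (σ : Fin n → Perm (Fin n)) (x : Fin n)
    (h2 : (Finset.univ.filter fun i => σ i x ≠ x).card = 2) (t : Fin n) (ht : σ t x ≠ x) :
    ∃ t', t' ≠ t ∧ σ t' x ≠ x ∧ ∀ u, σ u x ≠ x → u = t ∨ u = t' := by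
  have : ((Finset.univ.filter fun i => σ i x ≠ x).erase t).card = 1 := by
    rw [Finset.card_erase_of_mem (by simpa using ht), h2]
  obtain ⟨t', h'⟩ := Finset.card_eq_one.1 this
  have hm : ∀ u, (u ≠ t ∧ σ u x ≠ x) ↔ u = t' := by
    intro u
    rw [← Finset.mem_singleton, ← h']; simp
  refine ⟨t', ((hm t').2 rfl).1, ((hm t').2 rfl).2, fun u hu => ?_⟩
  by_cases h : u = t
  · exact Or.inl h
  · exact Or.inr ((hm u).1 ⟨h, hu⟩)

theorem cyc_structure {n : ℕ} (σ : Fin (n+2) → Perm (Fin (n+2))) (hs : ∀ i, (σ i).IsSwap)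
    (htr : ∀ x y : Fin (n+2), ∃ g ∈ Subgroup.closure (Set.range σ), g x = y)
    (hd : ∀ x : Fin (n+2), 2 ≤ Nat.card {i : Fin (n+2) // σ i x ≠ x})
    (t₀ x₀ : Fin (n+2)) (hx : σ t₀ x₀ ≠ x₀) :
    ∃ v l : Perm (Fin (n+2)), v 0 = x₀ ∧ l 0 = t₀ ∧ ∀ i, σ (l i) = swap (v i) (v (i+1)) := by
  have invσ : ∀ t x, σ t (σ t x) = x := by
    intro t x
    obtain ⟨a, b, -, h⟩ := hs t
    rw [h]; simp
  choose oth h1 h2 h3 using fun x => other_exists σ x (deg_two σ hs hd x)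
  let D := {p : Fin (n+2) × Fin (n+2) // σ p.2 p.1 ≠ p.1}
  let of : D → D := fun z => ⟨(z.1.1, oth z.1.1 z.1.2 z.2), h2 _ _ _⟩
  let sf : D → D := fun z => ⟨(σ z.1.2 z.1.1, z.1.2), fun h => z.2 (by
    have := (σ z.1.2).injective h; exact this)⟩
  have hof : Function.Involutive of := by
    rintro ⟨⟨x, t⟩, h⟩
    have e := h3 x _ (h2 x t h) t h
    have e' : oth x (oth x t h) (h2 x t h) = t := by
      rcases e with e | e
      · exact absurd e.symm (h1 x t h)
      · exact e.symm
    exact Subtype.ext (Prod.ext rfl e')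
  have hsf : Function.Involutive sf := by
    rintro ⟨⟨x, t⟩, h⟩
    exact Subtype.ext (Prod.ext (invσ t x) rfl)
  let o : Perm D := hof.toPerm
  let s : Perm D := hsf.toPerm
  let N : Perm D := o * s
  have fo : ∀ z, o z ≠ z := by
    rintro ⟨⟨x, t⟩, h⟩ e
    exact h1 x t h (congrArg (fun z : D => z.1.2) e)
  have fs : ∀ z, s z ≠ z := by
    rintro ⟨⟨x, t⟩, h⟩ e
    exact h (congrArg (fun z : D => z.1.1) e)
  have nr := no_reflect o s N hof hsf (fun z => rfl) fo fs
  have fst_eq : ∀ z z' : D, z.1.1 = z'.1.1 → z = z' ∨ z = o z' := by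
    rintro ⟨⟨x, t⟩, h⟩ ⟨⟨x', t'⟩, h'⟩ (rfl : x = x')
    rcases h3 x t' h' t h with e | e
    · left; exact Subtype.ext (Prod.ext rfl e)
    · right; exact Subtype.ext (Prod.ext rfl e)
  have snd_eq : ∀ z z' : D, z.1.2 = z'.1.2 → z = z' ∨ z = s z' := by
    rintro ⟨⟨x, t⟩, h⟩ ⟨⟨x', t'⟩, h'⟩ (rfl : t = t')
    by_cases e : x = x'
    · left; exact Subtype.ext (Prod.ext e rfl)
    · right
      refine Subtype.ext (Prod.ext (?_ : x = σ t x') rfl)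
      have hsw := swap_eq_of_apply (hs t) (x := x') rfl h'
      by_contra hc
      apply h
      change σ t x = x
      rw [hsw]
      exact swap_apply_of_ne_of_ne e hc
  let y₀ : D := ⟨(x₀, t₀), hx⟩
  have nr2 : ∀ (k j : ℤ), (N ^ k) y₀ ≠ o ((N ^ j) y₀) := by
    intro k j h
    apply nr ((N ^ j) y₀) (k - j)
    rw [← h, ← Perm.mul_apply, ← zpow_add]; simp
  have fst_inj : ∀ k j : ℤ, ((N ^ k) y₀).1.1 = ((N ^ j) y₀).1.1 → (N ^ k) y₀ = (N ^ j) y₀ :=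
    fun k j h => (fst_eq _ _ h).resolve_right (nr2 k j)
  have os : ∀ z, s z = o (N z) := fun z => (hof (s z)).symm
  have snd_inj : ∀ k j : ℤ, ((N ^ k) y₀).1.2 = ((N ^ j) y₀).1.2 → (N ^ k) y₀ = (N ^ j) y₀ := by
    intro k j h
    refine (snd_eq _ _ h).resolve_right fun e => nr2 k (1 + j) ?_
    rw [e, os, zpow_one_add]; rfl
  have surj : ∀ x, ∃ k : ℤ, ((N ^ k) y₀).1.1 = x := by
    intro x
    obtain ⟨g, hg, rfl⟩ := htr x₀ x
    have step : ∀ t x, (∃ k : ℤ, ((N ^ k) y₀).1.1 = x) → ∃ k : ℤ, ((N ^ k) y₀).1.1 = σ t x := by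
      rintro t x ⟨k, rfl⟩
      by_cases ht : σ t ((N ^ k) y₀).1.1 = ((N ^ k) y₀).1.1
      · exact ⟨k, ht.symm⟩
      · rcases h3 _ _ ((N ^ k) y₀).2 t ht with e | e
        · refine ⟨1 + k, ?_⟩
          rw [zpow_one_add, Perm.mul_apply, e]; rfl
        · refine ⟨-1 + k, ?_⟩
          rw [zpow_add, Perm.mul_apply, e]
          generalize (N ^ k) y₀ = z
          have : (N ^ (-1 : ℤ)) z = s (o z) := by
            rw [zpow_neg_one, Perm.inv_eq_iff_eq]
            change z = of (sf (sf (of z)))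
            rw [hsf, hof]
          rw [this]; rfl
    have : ∀ x, (∃ k : ℤ, ((N ^ k) y₀).1.1 = x) → ∃ k : ℤ, ((N ^ k) y₀).1.1 = g x := by
      induction hg using Subgroup.closure_induction with
      | mem g hg => obtain ⟨t, rfl⟩ := hg; exact step t
      | one => intro x h; exact h
      | mul a b _ _ ha hb => intro x h; exact ha _ (hb _ h)
      | inv a _ ha =>
        intro x h
        have hfin : a⁻¹ ∈ Submonoid.powers a := by
          rw [mem_powers_iff_mem_zpowers]
          exact Subgroup.inv_mem _ (Subgroup.mem_zpowers a)
        obtain ⟨m, hm⟩ := hfin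
        rw [← hm]
        change ∃ k : ℤ, _ = (a ^ m) x
        clear hm
        induction m with
        | zero => exact h
        | succ m ih => rw [pow_succ']; exact ha _ ih
    exact this x₀ ⟨0, rfl⟩
  have card : Nat.card {y // N.SameCycle y₀ y} = n + 2 := by
    rw [← Nat.card_fin (n + 2)]
    apply Nat.card_congr
    refine Equiv.ofBijective (fun y => y.1.1.1) ⟨?_, ?_⟩
    · rintro ⟨_, k, rfl⟩ ⟨_, j, rfl⟩ h
      exact Subtype.ext (fst_inj k j h)
    · intro x
      obtain ⟨k, hk⟩ := surj x
      exact ⟨⟨_, k, rfl⟩, hk⟩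
  have pe : ∀ k j : ℤ, (N ^ k) y₀ = (N ^ j) y₀ ↔ ((n + 2 : ℕ) : ℤ) ∣ k - j := by
    intro k j; rw [zpow_eq_iff, card]
  have pe' : ∀ i j : Fin (n+2), (N ^ (i : ℤ)) y₀ = (N ^ (j : ℤ)) y₀ → i = j := by
    intro i j h
    have := (pe _ _).1 h
    have h5 := i.2
    have h6 := j.2
    have h7 := Int.eq_zero_of_abs_lt_dvd this (by rw [abs_lt]; omega)
    apply Fin.ext; omega
  have vi : Function.Injective (fun i : Fin (n+2) => ((N ^ (i : ℤ)) y₀).1.1) :=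
    fun i j h => pe' i j (fst_inj _ _ h)
  have li : Function.Injective (fun i : Fin (n+2) => ((N ^ (i : ℤ)) y₀).1.2) :=
    fun i j h => pe' i j (snd_inj _ _ h)
  refine ⟨Equiv.ofBijective _ (Finite.injective_iff_bijective.1 vi),
    Equiv.ofBijective _ (Finite.injective_iff_bijective.1 li), rfl, rfl, fun i => ?_⟩
  have e : (N ^ ((i + 1 : Fin (n+2)) : ℤ)) y₀ = N ((N ^ (i : ℤ)) y₀) := by
    rw [← Perm.mul_apply, ← zpow_one_add, pe, Fin.val_add]
    refine ⟨-((((i : ℕ) + 1) / (n + 2) : ℕ) : ℤ), ?_⟩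
    have hm := Nat.mod_add_div ((i : ℕ) + 1) (n + 2)
    rw [Fin.val_one]
    have hm' : (((((i : ℕ) + 1) % (n + 2) : ℕ)) : ℤ)
      + ((n + 2 : ℕ) : ℤ) * ((((i : ℕ) + 1) / (n + 2) : ℕ) : ℤ) = (i : ℤ) + 1 := by exact_mod_cast hm
    linear_combination hm'
  change σ ((N ^ (i : ℤ)) y₀).1.2 = swap ((N ^ (i : ℤ)) y₀).1.1
    ((N ^ ((i + 1 : Fin (n+2)) : ℤ)) y₀).1.1
  rw [e]
  exact swap_eq_of_apply (hs _) rfl ((N ^ (i : ℤ)) y₀).2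


def lab {n : ℕ} (π : Perm (Fin (n+1))) : Perm (Fin (n+2)) :=
  (finRotate (n+2))⁻¹ * Perm.decomposeFin.symm (0, π)

theorem lab_zero {n : ℕ} (π : Perm (Fin (n+1))) : lab π 0 = Fin.last _ := by
  unfold lab
  rw [Perm.mul_apply, Perm.inv_eq_iff_eq]; simp

theorem lab_succ {n : ℕ} (π : Perm (Fin (n+1))) (i : Fin (n+1)) :
    lab π i.succ = (π i).castSucc := by
  unfold lab
  rw [Perm.mul_apply, Perm.inv_eq_iff_eq]; simp

theorem exists_lab {n : ℕ} (l : Perm (Fin (n+2))) (h0 : l 0 = Fin.last _) : ∃ π, lab π = l := by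
  obtain ⟨⟨p, π⟩, h⟩ := Perm.decomposeFin.symm.surjective (finRotate (n+2) * l)
  have hp : p = 0 := by
    have := congrArg (fun f => f 0) h
    simpa [h0] using this
  refine ⟨π, ?_⟩
  unfold lab
  rw [← hp, h]; simp

theorem lab_injective {n : ℕ} : Function.Injective (lab (n := n)) := by
  intro π π' h
  unfold lab at h
  have := Perm.decomposeFin.symm.injective (mul_left_cancel h)
  exact (Prod.ext_iff.1 this).2

theorem card_asc {n : ℕ} (π : Perm (Fin (n+1))) :
    Nat.card {i // Asc (lab π) i} = ascents π + 1 := by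
  classical
  have hs : ∀ i : Fin (n+1), Asc (lab π) i.succ ↔ lab π i.castSucc < (π i).castSucc := by
    intro i
    unfold Asc
    rw [lab_succ]
    have : i.succ - 1 = i.castSucc := by
      rw [sub_eq_iff_eq_add]; exact (Fin.coeSucc_eq_succ).symm
    rw [this]
  unfold ascents
  rw [Nat.card_eq_fintype_card, Fintype.card_subtype, Nat.card_eq_fintype_card,
    Fintype.card_subtype, Finset.card_filter, Finset.card_filter, Fin.sum_univ_succ,
    if_pos (asc_zero (lab_zero π)), Fin.sum_univ_succ, Fin.sum_univ_castSucc (n := n), if_neg, if_neg]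
  · have : ∀ k : Fin n, Asc (lab π) k.succ.succ ↔ 
      ∃ h : (k.castSucc : ℕ) + 1 < n + 1, π k.castSucc < π ⟨(k.castSucc : ℕ) + 1, h⟩ := by
      intro k
      rw [hs, ← Fin.succ_castSucc, lab_succ, Fin.castSucc_lt_castSucc_iff]
      constructor
      · intro h; exact ⟨by simp, h⟩
      · rintro ⟨_, h⟩; exact h
    simp only [this]
    omega
  · rintro ⟨h, -⟩
    simp at h
  · rw [hs]
    have := lab_zero π
    simp only [Fin.castSucc_zero, this, not_lt]
    exact Fin.le_last _

def toFac {n : ℕ} (l v : Perm (Fin (n+2))) (t : Fin (n+2)) : Perm (Fin (n+2)) :=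
  swap (v (l.symm t)) (v (l.symm t + 1))

theorem prod_toFac {n : ℕ} (l v : Perm (Fin (n+2))) :
    (List.ofFn (toFac l v)).prod = v * cyc l * v⁻¹ := by
  have := map_list_prod (MulAut.conj v) (List.ofFn fun t => swap (l.symm t) (l.symm t + 1))
  rw [MulAut.conj_apply] at this
  unfold cyc
  rw [this, List.map_ofFn]
  congr 2
  funext t
  simp only [Function.comp, MulAut.conj_apply, toFac, swap_apply_apply]

theorem moved_iff {n : ℕ} (l v : Perm (Fin (n+2))) (i t : Fin (n+2)) :
    toFac l v t (v i) ≠ v i ↔ t = l i ∨ t = l (i-1) := by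
  obtain ⟨e, rfl⟩ := l.surjective t
  simp only [toFac, symm_apply_apply, l.injective.eq_iff]
  constructor
  · intro h
    by_contra! hc
    apply h
    apply swap_apply_of_ne_of_ne
    · exact fun h => hc.1 (v.injective h).symm
    · intro h
      have := v.injective h
      exact hc.2 (by rw [this]; simp)
  · rintro (rfl | rfl)
    · simp
    · have := succ_ne (i-1)
      simp only [sub_add_cancel] at this ⊢
      rw [swap_apply_right]
      exact fun h => this (v.injective h).symm

theorem toFac_isPruned {n : ℕ} (l v T : Perm (Fin (n+2))) (hT : v * cyc l * v⁻¹ = T) :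
    IsPrunedFactorisation T (toFac l v) := by
  refine ⟨fun t => ⟨_, _, fun h => succ_ne _ (v.injective h).symm, rfl⟩,
    (prod_toFac l v).trans hT, ?_, ?_⟩
  · have h : ∀ i : Fin (n+2), ∃ g ∈ Subgroup.closure (Set.range (toFac l v)), g (v 0) = v i := by
      intro i
      induction i using Fin.induction with
      | zero => exact ⟨1, Subgroup.one_mem _, rfl⟩
      | succ i ih =>
        obtain ⟨g, hg, h⟩ := ih
        refine ⟨toFac l v (l i.castSucc) * g,
          Subgroup.mul_mem _ (Subgroup.subset_closure ⟨_, rfl⟩) hg, ?_⟩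
        rw [Perm.mul_apply, h]
        simp [toFac]
    intro x y
    obtain ⟨g, hg, hx⟩ := h (v.symm x)
    obtain ⟨g', hg', hy⟩ := h (v.symm y)
    refine ⟨g' * g⁻¹, Subgroup.mul_mem _ hg' (Subgroup.inv_mem _ hg), ?_⟩
    rw [apply_symm_apply] at hx hy
    rw [← hx, ← hy]; simp
  · intro x
    obtain ⟨i, rfl⟩ := v.surjective x
    have hne : l i ≠ l (i-1) := by
      intro h
      have := l.injective h
      exact succ_ne (i-1) (by simpa using this)
    rw [Nat.card_eq_fintype_card, Fintype.card_subtype]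
    refine (Finset.card_pair hne).symm.le.trans (Finset.card_le_card ?_)
    intro t ht
    rw [Finset.mem_filter]
    refine ⟨Finset.mem_univ _, (moved_iff l v i t).2 ?_⟩
    simpa using ht

theorem toFac_inj {n : ℕ} {l v l' v' : Perm (Fin (n+2))} (h : toFac l v = toFac l' v')
    (hl : l 0 = l' 0) (hv : v 0 = v' 0) : l = l' ∧ v = v' := by
  have key : ∀ i : Fin (n+2), l i = l' i ∧ v i = v' i := by
    intro i
    induction i using Fin.induction with
    | zero => exact ⟨hl, hv⟩
    | succ i ih =>
      obtain ⟨h1, h2⟩ := ih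
      have e : i.succ = i.castSucc + 1 := (Fin.coeSucc_eq_succ).symm
      rw [e]
      have h3 : v (i.castSucc + 1) = v' (i.castSucc + 1) := by
        have a1 : toFac l v (l i.castSucc) (v i.castSucc) = v (i.castSucc + 1) := by
          simp [toFac, -Fin.coeSucc_eq_succ]
        have a2 : toFac l' v' (l' i.castSucc) (v' i.castSucc) = v' (i.castSucc + 1) := by
          simp [toFac, -Fin.coeSucc_eq_succ]
        rw [← a1, ← a2, h, h1, h2]
      refine ⟨?_, h3⟩
      have m := (moved_iff l' v' (i.castSucc + 1) (l' (i.castSucc + 1))).2 (Or.inl rfl)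
      rw [← h, ← h3, moved_iff, add_sub_cancel_right] at m
      rcases m with m | m
      · exact m.symm
      · rw [h1] at m
        exact absurd (l'.injective m) (succ_ne _)
  exact ⟨Equiv.ext fun i => (key i).1, Equiv.ext fun i => (key i).2⟩

theorem main_count {n μ₁ μ₂ : ℕ} (T : Perm (Fin (n+2))) (h₁ : 1 ≤ μ₁)
    (hd : μ₁ + μ₂ = n + 2) (a b : Fin (n+2))
    (hab : ¬ T.SameCycle a b) (hcov : ∀ x, T.SameCycle a x ∨ T.SameCycle b x)
    (c1 : Nat.card {x // T.SameCycle a x} = μ₁) (c2 : Nat.card {x // T.SameCycle b x} = μ₂) :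
    Nat.card {σ : Fin (n+2) → Perm (Fin (n+2)) // IsPrunedFactorisation T σ}
      = μ₁ * μ₂ * eulerianNumber (n+1) (μ₁ - 1) := by
  let X := {p : Perm (Fin (n+1)) × Perm (Fin (n+2)) //
    p.2 * cyc (lab p.1) * p.2⁻¹ = T ∧ T.SameCycle a (p.2 0)}
  have conj : ∀ (l v : Perm (Fin (n+2))), v * cyc l * v⁻¹ = T → ∀ i j,
      (T.SameCycle (v i) (v j) ↔ (cyc l).SameCycle i j) := by
    rintro l v rfl i j
    rw [Perm.sameCycle_conj]; simp
  have hA : ∀ p : X, ∀ i, T.SameCycle a (p.1.2 i) ↔ Asc (lab p.1.1) i := by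
    rintro ⟨⟨π, v⟩, hv, h0⟩ i
    rw [← same_zero_iff (lab_zero π), ← conj _ _ hv]
    exact ⟨fun h => h0.symm.trans h, fun h => h0.trans h⟩
  have hasc : ∀ p : X, ascents p.1.1 = μ₁ - 1 := by
    intro p
    have : Nat.card {i // Asc (lab p.1.1) i} = μ₁ := by
      rw [← c1]
      exact Nat.card_congr (p.1.2.subtypeEquiv fun i => (hA p i).symm)
    rw [card_asc] at this
    omega
  have hB : ∀ p : X, T.SameCycle b (p.1.2 1) := fun p =>
    (hcov _).resolve_left fun h => asc_one (lab_zero _) ((hA p 1).1 h)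
  have e1 : Nat.card X = Nat.card {σ : Fin (n+2) → Perm (Fin (n+2)) // IsPrunedFactorisation T σ} := by
    refine Nat.card_congr (Equiv.ofBijective
      (fun p => ⟨toFac (lab p.1.1) p.1.2, toFac_isPruned _ _ _ p.2.1⟩) ⟨?_, ?_⟩)
    · rintro p p' h
      have h' : toFac (lab p.1.1) p.1.2 = toFac (lab p'.1.1) p'.1.2 := congrArg Subtype.val h
      have hl : lab p.1.1 0 = lab p'.1.1 0 := by rw [lab_zero, lab_zero]
      have hv : p.1.2 0 = p'.1.2 0 := by
        have m := (moved_iff (lab p'.1.1) p'.1.2 0 (lab p'.1.1 0)).2 (Or.inl rfl)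
        rw [← h', ← hl] at m
        by_contra hne
        apply m
        simp only [toFac, symm_apply_apply, zero_add]
        apply swap_apply_of_ne_of_ne (Ne.symm hne)
        intro e
        have q := (hA p' 0).2 (asc_zero (lab_zero _))
        rw [e, hA p] at q
        exact asc_one (lab_zero _) q
      obtain ⟨q1, q2⟩ := toFac_inj h' hl hv
      exact Subtype.ext (Prod.ext (lab_injective q1) q2)
    · rintro ⟨σ, hσ⟩
      obtain ⟨hs, hp, htr, hdg⟩ := hσ
      have str : ∀ x, σ (Fin.last _) x ≠ x → ∃ (π : Perm (Fin (n+1))) (v : Perm (Fin (n+2))),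
          v 0 = x ∧ σ = toFac (lab π) v ∧ v * cyc (lab π) * v⁻¹ = T := by
        intro x hx
        obtain ⟨v, l, hv, hl, hσ⟩ := cyc_structure σ hs htr hdg _ x hx
        obtain ⟨π, rfl⟩ := exists_lab l hl
        have e : σ = toFac (lab π) v := by
          funext t
          obtain ⟨i, rfl⟩ := (lab π).surjective t
          rw [hσ]; simp [toFac]
        exact ⟨π, v, hv, e, by rw [← prod_toFac, ← e, hp]⟩
      obtain ⟨x, y, hxy, hsw⟩ := hs (Fin.last _)
      obtain ⟨π, v, hv, hσ, hc⟩ := str x (by rw [hsw]; simpa using hxy.symm)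
      by_cases hx : T.SameCycle a x
      · exact ⟨⟨(π, v), hc, by rw [hv]; exact hx⟩, Subtype.ext hσ.symm⟩
      · obtain ⟨π', v', hv', hσ', hc'⟩ := str y (by rw [hsw]; simpa using hxy)
        refine ⟨⟨(π', v'), hc', ?_⟩, Subtype.ext hσ'.symm⟩
        change T.SameCycle a (v' 0)
        have y1 : y = v 1 := by
          have : σ (Fin.last _) x = v 1 := by
            rw [hσ, ← lab_zero π, ← hv]; simp [toFac]
          rw [← this, hsw]; simp
        rw [hv', y1]
        have hna : ¬ Asc (lab π) (v.symm a) := by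
          rw [← same_zero_iff (lab_zero π), ← conj _ _ hc, hv, apply_symm_apply]
          exact fun h => hx h.symm
        have := (conj _ _ hc _ _).2 (same_one (lab_zero π) _ hna)
        rw [apply_symm_apply] at this
        exact this.symm
  have e2 : Nat.card X = Nat.card ({π : Perm (Fin (n+1)) // ascents π = μ₁ - 1} ×
      {x // T.SameCycle a x} × {x // T.SameCycle b x}) := by
    refine Nat.card_congr (Equiv.ofBijective
      (fun p => (⟨p.1.1, hasc p⟩, ⟨p.1.2 0, p.2.2⟩, ⟨p.1.2 1, hB p⟩)) ⟨?_, ?_⟩)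
    · rintro ⟨⟨π, v⟩, hv, h0⟩ ⟨⟨π', v'⟩, hv', h0'⟩ h
      simp only [Prod.mk.injEq, Subtype.mk.injEq] at h
      obtain ⟨rfl, q0, q1⟩ := h
      refine Subtype.ext (Prod.ext rfl (Equiv.ext fun i => ?_))
      change v i = v' i
      have pw : ∀ (w : Perm (Fin (n+2))), w * cyc (lab π) * w⁻¹ = T → ∀ (k : ℤ) j,
          w ((cyc (lab π) ^ k) j) = (T ^ k) (w j) := by
        rintro w rfl k j
        rw [conj_zpow]; simp
      by_cases hi : Asc (lab π) i
      · obtain ⟨k, rfl⟩ := same_zero (lab_zero π) i hi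
        rw [pw v hv, pw v' hv', q0]
      · obtain ⟨k, rfl⟩ := same_one (lab_zero π) i hi
        rw [pw v hv, pw v' hv', q1]
    · rintro ⟨⟨π, hπ⟩, ⟨x, hx⟩, ⟨y, hy⟩⟩
      have cA : Nat.card {i // Asc (lab π) i} = μ₁ := by rw [card_asc, hπ]; omega
      have cD : Nat.card {i // ¬ Asc (lab π) i} = μ₂ := by
        classical
        have := Fintype.card_subtype_compl (fun i => Asc (lab π) i)
        rw [← Nat.card_eq_fintype_card, ← Nat.card_eq_fintype_card,
          ← Nat.card_eq_fintype_card, cA, Nat.card_fin] at this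
        rw [this]; omega
      have n01 : ¬ (cyc (lab π)).SameCycle 0 1 := by
        rw [same_zero_iff (lab_zero π)]; exact asc_one (lab_zero π)
      have one_iff : ∀ i, (cyc (lab π)).SameCycle 1 i ↔ ¬ Asc (lab π) i := by
        intro i
        refine ⟨fun h h' => n01 ((same_zero (lab_zero π) i h').trans h.symm), same_one (lab_zero π) i⟩
      have sx : ∀ z, T.SameCycle x z ↔ T.SameCycle a z := fun z =>
        ⟨fun h => hx.trans h, fun h => hx.symm.trans h⟩
      have sy : ∀ z, T.SameCycle y z ↔ T.SameCycle b z := fun z =>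
        ⟨fun h => hy.trans h, fun h => hy.symm.trans h⟩
      obtain ⟨v, v0, v1, hv⟩ := exists_intertwine (cyc (lab π)) T (x₀ := 0) (x₁ := 1) (y₀ := x) (y₁ := y)
        (fun i => by rw [same_zero_iff (lab_zero π), one_iff]; exact em _) n01
        (fun z => by rw [sx, sy]; exact hcov z)
        (by rw [sx]; exact fun h => hab (h.trans hy.symm))
        (by simp only [same_zero_iff (lab_zero π), sx]; rw [cA, c1])
        (by simp only [one_iff, sy]; rw [cD, c2])
      have hc : v * cyc (lab π) * v⁻¹ = T := by
        ext z : 1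
        obtain ⟨i, rfl⟩ := v.surjective z
        simpa using hv i
      refine ⟨⟨(π, v), hc, by change T.SameCycle a (v 0); rw [v0]; exact hx⟩, ?_⟩
      simp only [Prod.mk.injEq, Subtype.mk.injEq]
      exact ⟨trivial, v0, v1⟩
  rw [← e1, e2, Nat.card_prod, Nat.card_prod, c1, c2, eulerianNumber, mul_comm]
/-- Pruned simple Hurwitz number `K_{0,2}(μ₁, μ₂) = μ₁ · μ₂ · A(μ₁+μ₂-1, μ₁-1)`:
here `T` is a fixed permutation of `{1, …, μ₁+μ₂}` of cycle type `(μ₁, μ₂)` and the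
number of factorisations of `T` into `m = 2·0 - 2 + 2 + (μ₁+μ₂) = μ₁+μ₂` transpositions
generating a transitive subgroup, with every point moved by at least two of the
transpositions, equals `μ₁ · μ₂` times an Eulerian number. -/
theorem prunedHurwitz_genus_zero_two_part (μ₁ μ₂ : ℕ) (h₁ : 1 ≤ μ₁) (h₂ : 1 ≤ μ₂)
    (T : Equiv.Perm (Fin (μ₁ + μ₂)))
    (hT : T.cycleType = Multiset.filter (fun x => 2 ≤ x) ({μ₁, μ₂} : Multiset ℕ)) :
    Nat.card {σ : Fin (μ₁ + μ₂) → Equiv.Perm (Fin (μ₁ + μ₂)) // IsPrunedFactorisation T σ}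
      = μ₁ * μ₂ * eulerianNumber (μ₁ + μ₂ - 1) (μ₁ - 1) := by
  obtain ⟨a, b, hab, hcov, c1, c2⟩ := orbits_exist μ₁ μ₂ _ h₁ h₂ rfl T hT
  obtain ⟨n, hn⟩ : ∃ n, μ₁ + μ₂ = n + 2 := ⟨μ₁ + μ₂ - 2, by omega⟩
  clear hT
  have hd : μ₁ + μ₂ = n + 2 := hn
  have key : ∀ d (_ : d = n + 2) (T : Equiv.Perm (Fin d)) (a b : Fin d)
      (_ : ¬ T.SameCycle a b) (_ : ∀ x, T.SameCycle a x ∨ T.SameCycle b x)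
      (_ : Nat.card {x // T.SameCycle a x} = μ₁) (_ : Nat.card {x // T.SameCycle b x} = μ₂),
      Nat.card {σ : Fin d → Equiv.Perm (Fin d) // IsPrunedFactorisation T σ}
        = μ₁ * μ₂ * eulerianNumber (d - 1) (μ₁ - 1) := by
    rintro d rfl T a b hab hcov c1 c2
    exact main_count T h₁ hd a b hab hcov c1 c2
  exact key _ hn T a b hab hcov c1 c2
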